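/- For every integer n > 0, s₁(n) = (δ(n) − δ(n+1) + ⌊log₂ n⌋)/2 + 1; equivalently, 2·s₁(n) = δ(n) − δ(n+1) + ⌊log₂ n⌋ + 2 as integers. -/

import Mathlib

/-- Number of D-nodes in the divide-and-conquer tree on `n` leaves:
`δ(1) = 0`, `δ(2m) = 2·δ(m)`, `δ(2m+1) = δ(m) + δ(m+1) + 1`. -/
def delta : ℕ → ℕ
  | 0 => 0
  | 1 => 0
  | n + 2 =>
    if (n + 2) % 2 = 0 then 2 * delta ((n + 2) / 2)
    else delta ((n + 2) / 2) + delta ((n + 2) / 2 + 1) + 1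
decreasing_by all_goals (simp_wf; omega)

/-- Hamming weight of `n`: number of 1s in the binary expansion of `n`. -/
def s1 (n : ℕ) : ℕ := (Nat.digits 2 n).sum

theorem delta_two_mul {m : ℕ} (hm : 0 < m) : delta (2 * m) = 2 * delta m := by
  obtain ⟨k, rfl⟩ := Nat.exists_eq_succ_of_ne_zero hm.ne'
  rw [show 2 * k.succ = 2 * k + 2 by omega, delta, if_pos (by omega),
    show (2 * k + 2) / 2 = k.succ by omega]

theorem delta_two_mul_add_one {m : ℕ} (hm : 0 < m) :
    delta (2 * m + 1) = delta m + delta (m + 1) + 1 := by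
  obtain ⟨k, rfl⟩ := Nat.exists_eq_succ_of_ne_zero hm.ne'
  rw [show 2 * k.succ + 1 = (2 * k + 1) + 2 by omega, delta, if_neg (by omega),
    show (2 * k + 1 + 2) / 2 = k.succ by omega]

theorem s1_eq_mod_add_div {n : ℕ} (hn : 0 < n) : s1 n = n % 2 + s1 (n / 2) := by
  rw [s1, Nat.digits_def' one_lt_two hn, List.sum_cons, s1]

theorem log_two_eq_log_div_add_one {n : ℕ} (hn : 2 ≤ n) :
    Nat.log 2 n = Nat.log 2 (n / 2) + 1 :=
  Nat.log_of_one_lt_of_le one_lt_two hn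

theorem s1_eq_delta_diff (n : ℕ) (hn : 0 < n) :
    2 * (s1 n : ℤ) = (delta n : ℤ) - (delta (n + 1) : ℤ) + (Nat.log 2 n : ℤ) + 2 := by
  induction n using Nat.strong_induction_on with
  | _ n ih =>
    obtain rfl | h2 : n = 1 ∨ 2 ≤ n := by omega
    · have h : delta 2 = 2 * delta 1 := delta_two_mul one_pos
      have h1 : delta 1 = 0 := by rw [delta]
      simp [s1, h, h1]
    · have hs := s1_eq_mod_add_div hn
      have hl := log_two_eq_log_div_add_one h2
      have hi := ih (n / 2) (by omega) (by omega)
      have hm : 0 < n / 2 := by omega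
      have he := delta_two_mul hm
      have ho := delta_two_mul_add_one hm
      have he' := delta_two_mul (Nat.succ_pos (n / 2))
      obtain h | h := Nat.mod_two_eq_zero_or_one n
      · rw [show 2 * (n / 2) = n by omega] at he ho
        omega
      · rw [show 2 * (n / 2) + 1 = n by omega] at ho
        rw [show 2 * (n / 2).succ = n + 1 by omega] at he'
        simp only [Nat.succ_eq_add_one] at he'
        omega
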